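/- Let C ≥ 2, c ∈ {1, …, C}, α ∈ [0, 1), γ ∈ [0, 1), and let s ∈ ℝ^C be nonzero. Define ŷ = (1−α) • e_c + (α/C) • 𝟙 and ỹ = γ • ( (1/‖ŷ‖) • ŷ ) + (1−γ) • ( (1/‖s‖) • s ). Then for all indices k, l with k ≠ c and l ≠ c: ỹ_k ≤ ỹ_l if and only if s_k ≤ s_l. That is, label refinement preserves the ordering of the soft label's non-target coordinates. -/

import Mathlib

/-- The all-ones vector `𝟙` in `ℝ^C` (with the Euclidean norm). -/
noncomputable def allOnes (C : ℕ) : EuclideanSpace ℝ (Fin C) :=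
  (WithLp.equiv 2 (Fin C → ℝ)).symm fun _ => 1

/-- The smoothed hard label `ŷ = (1−α) • e_c + (α/C) • 𝟙` in `ℝ^C`. -/
noncomputable def smoothedLabel (C : ℕ) (c : Fin C) (α : ℝ) : EuclideanSpace ℝ (Fin C) :=
  (1 - α) • EuclideanSpace.single c (1 : ℝ) + (α / C) • allOnes C

/-- The refined label `ỹ = γ • (ŷ/‖ŷ‖) + (1−γ) • (s/‖s‖)` obtained from the smoothed hard
label `ŷ` and the soft label `s`. -/
noncomputable def refinedLabel (C : ℕ) (c : Fin C) (α γ : ℝ)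
    (s : EuclideanSpace ℝ (Fin C)) : EuclideanSpace ℝ (Fin C) :=
  γ • ((1 / ‖smoothedLabel C c α‖) • smoothedLabel C c α) + (1 - γ) • ((1 / ‖s‖) • s)

/-- All non-target coordinates of the smoothed label equal `α / C`. -/
theorem smoothedLabel_apply_of_ne {C : ℕ} {c k : Fin C} (α : ℝ) (hk : k ≠ c) :
    smoothedLabel C c α k = α / C := by
  simp [smoothedLabel, allOnes, hk]

/-- Label refinement preserves the ordering of the soft label's non-target coordinates:
for all `k ≠ c` and `l ≠ c`, `ỹ_k ≤ ỹ_l ↔ s_k ≤ s_l`. -/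
theorem refined_label_preserves_nontarget_order
    (C : ℕ) (hC : 2 ≤ C) (c : Fin C) (α : ℝ) (hα : α ∈ Set.Ico (0 : ℝ) 1)
    (γ : ℝ) (hγ : γ ∈ Set.Ico (0 : ℝ) 1)
    (s : EuclideanSpace ℝ (Fin C)) (hs : s ≠ 0) :
    ∀ k l, k ≠ c → l ≠ c →
      (refinedLabel C c α γ s k ≤ refinedLabel C c α γ s l ↔ s k ≤ s l) := by
  intro k l hk hl
  have hγ' : 0 < 1 - γ := sub_pos.mpr hγ.2
  have hs' : 0 < 1 / ‖s‖ := one_div_pos.mpr (norm_pos_iff.mpr hs)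
  simp only [refinedLabel, PiLp.add_apply, PiLp.smul_apply, smul_eq_mul,
    smoothedLabel_apply_of_ne α hk, smoothedLabel_apply_of_ne α hl]
  rw [add_le_add_iff_left, mul_le_mul_iff_right₀ hγ', mul_le_mul_iff_right₀ hs']
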